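/- Let v, x, w, h ∈ ℝⁿ with v·x = 0, |w − v| ≤ |v|/(4√2), |h| < 1 + |x|/√2, and suppose 2⁵ n max(β^l_1, β^l_2) ≤ α |v|² (1 + |x|/√2 − |h|)^α. Then for each sign ±, there exists a unique function z ∈ C²(ℝ, ℝⁿ) satisfying: z̈(t) = F^l(z(t)) for all t ∈ ℝ, z(0) = x + h, ż(t) − w → 0 as t → ±∞, and |z(t) − x − h − tw| ≤ (2^{5/2} √n β^l_1 / (α |v| (1 + |x|/√2 − |h|)^α)) |t| for all t ∈ ℝ. -/

import Mathlib

open MeasureTheory Real Filter Set Topology RealInnerProductSpace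

noncomputable section

namespace Paper

/-- ℝⁿ -/
abbrev Euc (n : ℕ) : Type := EuclideanSpace ℝ (Fin n)

variable {n : ℕ}

/-- the norm `sup_{t ≤ 0} ‖f t‖ + sup_{t ≥ 0} ‖f t‖/(1+t)` on the space `M_r`. -/
def Mnorm (f : ℝ → Euc n) : ℝ :=
  sSup ((fun t => ‖f t‖) '' Iic 0) + sSup ((fun t => ‖f t‖ / (1 + t)) '' Ici 0)

/-- membership in the complete metric space `M_r`. -/
def MemM (r : ℝ) (f : ℝ → Euc n) : Prop :=
  Continuous f ∧ BddAbove ((fun t => ‖f t‖) '' Iic 0) ∧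
    BddAbove ((fun t => ‖f t‖ / (1 + t)) '' Ici 0) ∧ Mnorm f ≤ r

/-- the long range decay conditions on `V^l`. -/
def LongRange (α βl0 βl1 βl2 : ℝ) (Vl : Euc n → ℝ) : Prop :=
  ContDiff ℝ 2 Vl ∧
    (∀ x, |Vl x| ≤ βl0 * (1 + ‖x‖) ^ (-α)) ∧
    (∀ x, ‖gradient Vl x‖ ≤ βl1 * (1 + ‖x‖) ^ (-(α + 1))) ∧
    (∀ x, ‖iteratedFDeriv ℝ 2 Vl x‖ ≤ βl2 * (1 + ‖x‖) ^ (-(α + 2)))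

/-- the short range decay conditions on `V^s`. -/
def ShortRange (α βs1 βs2 βs3 : ℝ) (Vs : Euc n → ℝ) : Prop :=
  ContDiff ℝ 2 Vs ∧
    (∀ x, |Vs x| ≤ βs1 * (1 + ‖x‖) ^ (-(α + 1))) ∧
    (∀ x, ‖gradient Vs x‖ ≤ βs2 * (1 + ‖x‖) ^ (-(α + 2))) ∧
    (∀ x, ‖iteratedFDeriv ℝ 2 Vs x‖ ≤ βs3 * (1 + ‖x‖) ^ (-(α + 3)))

/-- `z` is a C² solution of `z'' = Fl ∘ z` with `z 0 = x0`, `z' → w` along the filter `l`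
(`atBot` for `z_-`, `atTop` for `z_+`), satisfying the growth bound `‖z t - x0 - t w‖ ≤ C |t|`. -/
def IsFreeSol (Fl : Euc n → Euc n) (x0 w : Euc n) (l : Filter ℝ) (C : ℝ)
    (z : ℝ → Euc n) : Prop :=
  ContDiff ℝ 2 z ∧ (∀ t, deriv (deriv z) t = Fl (z t)) ∧ z 0 = x0 ∧
    Tendsto (fun t => deriv z t) l (𝓝 w) ∧ ∀ t, ‖z t - x0 - t • w‖ ≤ C * |t|

/-- the map `A` (or `𝒜` when `xm = 0` and `zm` already contains the base point). -/
def Aop (Fl F : Euc n → Euc n) (zm : ℝ → Euc n) (xm : Euc n)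
    (f : ℝ → Euc n) (t : ℝ) : Euc n :=
  ∫ σ in Iic t, ∫ τ in Iic σ, (F (zm τ + xm + f τ) - Fl (zm τ))

/-- the vector `l(v_-,x_-,y_-)`. -/
def lInt (Fl Fs F : Euc n → Euc n) (zm : ℝ → Euc n) (xm : Euc n) (ym : ℝ → Euc n) : Euc n :=
  (∫ σ in Iic (0:ℝ), ∫ τ in Iic σ, (F (zm τ + xm + ym τ) - Fl (zm τ))) -
    ∫ σ in Ici (0:ℝ), ∫ τ in Ici σ, Fs (zm τ + xm + ym τ)

/-- the vector `l₁(v_-,x_-)`. -/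
def l1Int (Fl : Euc n → Euc n) (zp : ℝ → Euc n) (xm : Euc n) : Euc n :=
  -∫ σ in Ici (0:ℝ), ∫ τ in Ici σ, (Fl (zp τ + xm) - Fl (zp τ))

/-- the vector `l₂(v_-,x_-,y_-)`. -/
def l2Int (Fl : Euc n → Euc n) (zm zp : ℝ → Euc n) (xm : Euc n) (ym : ℝ → Euc n) : Euc n :=
  -∫ σ in Ici (0:ℝ), ∫ τ in Ici σ, (Fl (zm τ + xm + ym τ) - Fl (zp τ + xm))

/-- the function `y_+`. -/
def yplusInt (Fl F : Euc n → Euc n) (zm zp : ℝ → Euc n) (xm : Euc n) (ym : ℝ → Euc n)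
    (t : ℝ) : Euc n :=
  ∫ σ in Ici t, ∫ τ in Ici σ, (F (zm τ + xm + ym τ) - Fl (zp τ))

/-- the vector `W(v_-,x_-)`. -/
def Wvec (Fl : Euc n → Euc n) (zm zp : ℝ → Euc n) (xm : Euc n) : Euc n :=
  (∫ σ in Iic (0:ℝ), ∫ τ in Iic σ, (Fl (zm τ + xm) - Fl (zm τ))) -
    ∫ σ in Ici (0:ℝ), ∫ τ in Ici σ, (Fl (zp τ + xm) - Fl (zp τ))

/-- the map `𝒢_{v_-,x_-}`; here `zm = z_-(v_-,x_-,·)` contains the base point `x_-`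
and `zp h = z_+(ã, x_- + h, ·)`. -/
def Gmap (Fl Fs F : Euc n → Euc n) (zm : ℝ → Euc n) (zp : Euc n → ℝ → Euc n)
    (ym : ℝ → Euc n) (h : Euc n) : Euc n :=
  lInt Fl Fs F zm 0 ym -
    ∫ σ in Ici (0:ℝ), ∫ τ in Ici σ, (Fl (zm τ + ym τ) - Fl (zp h τ))

/-- the vector `W̃(v_-,x_-)`; here `zp0 = z_+(ã, x_-, ·)`. -/
def Wtilde (Fl : Euc n → Euc n) (zm zp0 : ℝ → Euc n) : Euc n :=
  (∫ τ in Iic (0:ℝ), Fl (zm τ)) + ∫ τ in Ici (0:ℝ), Fl (zp0 τ)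

section TailPrimitive

variable {E : Type*} [NormedAddCommGroup E] [NormedSpace ℝ E]

/-- the primitive of `f` which vanishes at `+∞`. -/
def tailPrimitive (f : ℝ → E) (t : ℝ) : E :=
  (∫ τ in (0:ℝ)..t, f τ) - ∫ τ in Ioi (0:ℝ), f τ

theorem hasDerivAt_integral_zero [CompleteSpace E] {f : ℝ → E} (hf : Continuous f) (t : ℝ) :
    HasDerivAt (fun s => ∫ τ in (0:ℝ)..s, f τ) (f t) t :=
  intervalIntegral.integral_hasDerivAt_right (hf.intervalIntegrable _ _)
    hf.aestronglyMeasurable.stronglyMeasurableAtFilter hf.continuousAt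

theorem hasDerivAt_tailPrimitive [CompleteSpace E] {f : ℝ → E} (hf : Continuous f) (t : ℝ) :
    HasDerivAt (tailPrimitive f) (f t) t :=
  (hasDerivAt_integral_zero hf t).sub_const _

theorem tailPrimitive_eq_neg_integral {f : ℝ → E} (hf : Integrable f) (t : ℝ) :
    tailPrimitive f t = -∫ τ in Ioi t, f τ := by
  rw [tailPrimitive, ← intervalIntegral.integral_interval_add_Ioi
    (a := (0:ℝ)) (b := t) hf.integrableOn hf.integrableOn]
  abel

theorem norm_tailPrimitive_le {f : ℝ → E} {g : ℝ → ℝ} (hf : Integrable f) (hg : Integrable g)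
    (hfg : ∀ t, ‖f t‖ ≤ g t) (t : ℝ) : ‖tailPrimitive f t‖ ≤ ∫ τ, g τ := by
  rw [tailPrimitive_eq_neg_integral hf, norm_neg]
  refine (norm_integral_le_of_norm_le hg.integrableOn (ae_of_all _ hfg)).trans ?_
  exact setIntegral_le_integral hg (ae_of_all _ fun t => (norm_nonneg _).trans (hfg t))

theorem tailPrimitive_sub {f₁ f₂ : ℝ → E} (hf₁ : Integrable f₁) (hf₂ : Integrable f₂) (t : ℝ) :
    tailPrimitive (f₁ - f₂) t = tailPrimitive f₁ t - tailPrimitive f₂ t := by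
  rw [tailPrimitive_eq_neg_integral hf₁, tailPrimitive_eq_neg_integral hf₂,
    tailPrimitive_eq_neg_integral (hf₁.sub hf₂),
    integral_sub' hf₁.integrableOn hf₂.integrableOn]
  abel

theorem tendsto_tailPrimitive_atTop {f : ℝ → E} (hf : Integrable f) :
    Tendsto (tailPrimitive f) atTop (𝓝 0) := by
  have h := (intervalIntegral_tendsto_integral_Ioi 0 hf.integrableOn tendsto_id).sub_const
    (∫ τ in Ioi (0:ℝ), f τ)
  rwa [sub_self] at h

theorem norm_integral_zero_le {f : ℝ → E} {C : ℝ} (hf : ∀ t, ‖f t‖ ≤ C) (t : ℝ) :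
    ‖∫ τ in (0:ℝ)..t, f τ‖ ≤ C * |t| := by
  simpa using intervalIntegral.norm_integral_le_of_norm_le_const (a := (0:ℝ)) (b := t)
    fun τ _ => hf τ

end TailPrimitive

/-- Picard iteration for the velocity `z' - w` on the ball of radius `C` of bounded continuous
functions. -/
theorem existsUnique_isFreeSol_atTop {Fl : Euc n → Euc n} (hFl : Continuous Fl) (a w : Euc n)
    {C q : ℝ} {g k : ℝ → ℝ} (hC : 0 ≤ C) (hg : Integrable g) (hk : Integrable k)
    (hgC : ∫ t, g t ≤ C) (hkq : ∫ t, k t ≤ q) (hq0 : 0 ≤ q) (hq : q < 1)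
    (hbound : ∀ t y, ‖y‖ ≤ C * |t| → ‖Fl (a + t • w + y)‖ ≤ g t)
    (hlip : ∀ t y₁ y₂ d, 0 ≤ d → ‖y₁‖ ≤ C * |t| → ‖y₂‖ ≤ C * |t| → ‖y₁ - y₂‖ ≤ d * |t| →
      ‖Fl (a + t • w + y₁) - Fl (a + t • w + y₂)‖ ≤ k t * d) :
    ∃! z : ℝ → Euc n, IsFreeSol Fl a w atTop C z := by
  let S := Metric.closedBall (0 : BoundedContinuousFunction ℝ (Euc n)) C
  have : CompleteSpace S := Metric.isClosed_closedBall.isComplete.completeSpace_coe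
  have : Nonempty S := ⟨⟨0, Metric.mem_closedBall_self hC⟩⟩
  have hS (u : S) (t : ℝ) : ‖u.1 t‖ ≤ C :=
    (u.1.norm_coe_le_norm t).trans (mem_closedBall_zero_iff.1 u.2)
  obtain ⟨y, hy⟩ : ∃ y : S → ℝ → Euc n, ∀ u t, y u t = ∫ τ in (0:ℝ)..t, u.1 τ :=
    ⟨_, fun _ _ => rfl⟩
  have hyd (u : S) (t : ℝ) : HasDerivAt (y u) (u.1 t) t := by
    rw [show y u = _ from funext (hy u)]
    exact hasDerivAt_integral_zero u.1.continuous t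
  have hyc (u : S) : Continuous (y u) :=
    continuous_iff_continuousAt.2 fun t => (hyd u t).continuousAt
  have hyC (u : S) (t : ℝ) : ‖y u t‖ ≤ C * |t| := by
    rw [hy]; exact norm_integral_zero_le (hS u) t
  have hydist (u₁ u₂ : S) (t : ℝ) : ‖y u₁ t - y u₂ t‖ ≤ dist u₁ u₂ * |t| := by
    rw [hy, hy, ← intervalIntegral.integral_sub (u₁.1.continuous.intervalIntegrable _ _)
      (u₂.1.continuous.intervalIntegrable _ _)]
    refine norm_integral_zero_le (fun τ => ?_) t
    rw [← dist_eq_norm]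
    exact BoundedContinuousFunction.dist_coe_le_dist τ
  obtain ⟨f, hf⟩ : ∃ f : S → ℝ → Euc n, ∀ u t, f u t = Fl (a + t • w + y u t) :=
    ⟨_, fun _ _ => rfl⟩
  have hfc (u : S) : Continuous (f u) := by
    rw [show f u = _ from funext (hf u)]
    have := hyc u
    fun_prop
  have hfg (u : S) (t : ℝ) : ‖f u t‖ ≤ g t := by
    rw [hf]; exact hbound t _ (hyC u t)
  have hfi (u : S) : Integrable (f u) :=
    hg.mono' (hfc u).aestronglyMeasurable (ae_of_all _ (hfg u))
  have hTc (u : S) : Continuous (tailPrimitive (f u)) :=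
    continuous_iff_continuousAt.2 fun t => (hasDerivAt_tailPrimitive (hfc u) t).continuousAt
  have hTC (u : S) (t : ℝ) : ‖tailPrimitive (f u) t‖ ≤ C :=
    (norm_tailPrimitive_le (hfi u) hg (hfg u) t).trans hgC
  obtain ⟨T, hT⟩ : ∃ T : S → S, ∀ u t, (T u).1 t = tailPrimitive (f u) t :=
    ⟨fun u => ⟨BoundedContinuousFunction.ofNormedAddCommGroup _ (hTc u) C (hTC u),
      mem_closedBall_zero_iff.2
        (BoundedContinuousFunction.norm_ofNormedAddCommGroup_le _ hC (hTC u))⟩,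
      fun _ _ => rfl⟩
  have hcontr : ContractingWith (NNReal.mk q hq0) T := by
    refine ⟨by exact_mod_cast hq, LipschitzWith.of_dist_le_mul fun u₁ u₂ => ?_⟩
    rw [Subtype.dist_eq, NNReal.coe_mk]
    refine (BoundedContinuousFunction.dist_le (by positivity)).2 fun t => ?_
    rw [hT, hT, dist_eq_norm, ← tailPrimitive_sub (hfi u₁) (hfi u₂)]
    refine (norm_tailPrimitive_le ((hfi u₁).sub (hfi u₂)) (hk.mul_const (dist u₁ u₂))
      (fun τ => ?_) t).trans ?_
    · rw [Pi.sub_apply, hf, hf]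
      exact hlip τ _ _ _ dist_nonneg (hyC u₁ τ) (hyC u₂ τ) (hydist u₁ u₂ τ)
    · rw [integral_mul_const]
      gcongr
  refine existsUnique_of_exists_of_unique ?_ ?_
  · obtain ⟨u, hu⟩ : ∃ u, T u = u := ⟨_, hcontr.fixedPoint_isFixedPt⟩
    have hut (t : ℝ) : u.1 t = tailPrimitive (f u) t := by rw [← hT, hu]
    have hz (t : ℝ) : HasDerivAt (fun s => a + s • w + y u s) (w + u.1 t) t := by
      simpa using (((hasDerivAt_id t).smul_const w).const_add a).fun_add (hyd u t)
    have hz' : deriv (fun s => a + s • w + y u s) = fun t => w + u.1 t :=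
      funext fun t => (hz t).deriv
    have hzz (t : ℝ) : HasDerivAt (fun t => w + u.1 t) (f u t) t := by
      rw [show (fun t => w + u.1 t) = _ from funext fun t => congrArg (w + ·) (hut t)]
      exact (hasDerivAt_tailPrimitive (hfc u) t).const_add w
    have hzz' : deriv (fun t => w + u.1 t) = f u := funext fun t => (hzz t).deriv
    refine ⟨fun s => a + s • w + y u s, ?_, ?_, ?_, ?_, ?_⟩
    · rw [show (2 : WithTop ℕ∞) = 1 + 1 from one_add_one_eq_two.symm, contDiff_succ_iff_deriv]
      refine ⟨fun t => (hz t).differentiableAt, by simp, ?_⟩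
      rw [hz', contDiff_one_iff_deriv, hzz']
      exact ⟨fun t => (hzz t).differentiableAt, hfc u⟩
    · intro t
      rw [hz', hzz', hf]
    · simp [hy]
    · rw [hz']
      have := (tendsto_tailPrimitive_atTop (hfi u)).const_add w
      simpa only [hut, add_zero] using this
    · intro t
      simpa [add_assoc] using hyC u t
  · suffices H : ∀ z, IsFreeSol Fl a w atTop C z →
        ∃ u : S, T u = u ∧ z = fun t => a + t • w + y u t by
      intro z₁ z₂ h₁ h₂
      obtain ⟨u₁, hu₁, rfl⟩ := H z₁ h₁
      obtain ⟨u₂, hu₂, rfl⟩ := H z₂ h₂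
      rw [hcontr.fixedPoint_unique' hu₁ hu₂]
    rintro z ⟨hz2, hode, hz0, hlim, hzC⟩
    have hzd : Differentiable ℝ z := hz2.differentiable (by norm_num)
    have hz1 : ContDiff ℝ 1 (deriv z) := by
      rw [show (2 : WithTop ℕ∞) = 1 + 1 from one_add_one_eq_two.symm,
        contDiff_succ_iff_deriv] at hz2
      exact hz2.2.2
    have hFc : Continuous fun t => Fl (z t) := hFl.comp hzd.continuous
    have hFg (t : ℝ) : ‖Fl (z t)‖ ≤ g t := by
      simpa using hbound t _ (hzC t)
    have hFi : Integrable fun t => Fl (z t) :=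
      hg.mono' hFc.aestronglyMeasurable (ae_of_all _ hFg)
    have hint (t : ℝ) : ∫ τ in (0:ℝ)..t, Fl (z τ) = deriv z t - deriv z 0 := by
      refine intervalIntegral.integral_eq_sub_of_hasDerivAt (fun τ _ => ?_)
        (hFc.intervalIntegrable _ _)
      rw [← hode]
      exact (hz1.differentiable (by norm_num) τ).hasDerivAt
    have hIoi : ∫ τ in Ioi (0:ℝ), Fl (z τ) = w - deriv z 0 := by
      refine tendsto_nhds_unique
        (intervalIntegral_tendsto_integral_Ioi 0 hFi.integrableOn tendsto_id) ?_
      simpa only [hint, id] using hlim.sub_const (deriv z 0)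
    have htail (t : ℝ) : tailPrimitive (fun τ => Fl (z τ)) t = deriv z t - w := by
      rw [tailPrimitive, hint, hIoi]; abel
    have hbd (t : ℝ) : ‖deriv z t - w‖ ≤ C := by
      rw [← htail]; exact (norm_tailPrimitive_le hFi hg hFg t).trans hgC
    let u : S := ⟨BoundedContinuousFunction.ofNormedAddCommGroup (fun t => deriv z t - w)
      (hz1.continuous.sub continuous_const) C hbd, mem_closedBall_zero_iff.2
        (BoundedContinuousFunction.norm_ofNormedAddCommGroup_le _ hC hbd)⟩
    have hu (t : ℝ) : u.1 t = deriv z t - w := rfl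
    have hzu (t : ℝ) : z t = a + t • w + y u t := by
      have : y u t = (z t - t • w) - (z 0 - (0:ℝ) • w) := by
        rw [hy]
        refine intervalIntegral.integral_eq_sub_of_hasDerivAt
          (f := fun t => z t - t • w) (fun τ _ => ?_) (u.1.continuous.intervalIntegrable _ _)
        simpa [hu] using (hzd τ).hasDerivAt.fun_sub ((hasDerivAt_id τ).smul_const w)
      rw [this, hz0, zero_smul]; abel
    refine ⟨u, Subtype.ext (BoundedContinuousFunction.ext fun t => ?_), funext hzu⟩
    rw [hT, hu, ← htail]
    congr 1
    funext τ
    rw [hf, ← hzu]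

theorem IsFreeSol.comp_neg {Fl : Euc n → Euc n} {a w : Euc n} {l : Filter ℝ} {C : ℝ}
    {z : ℝ → Euc n} (hz : IsFreeSol Fl a w l C z) :
    IsFreeSol Fl a (-w) (comap Neg.neg l) C fun t => z (-t) := by
  obtain ⟨h1, h2, h3, h4, h5⟩ := hz
  have hd : deriv (fun t => z (-t)) = fun t => -deriv z (-t) :=
    funext fun t => deriv_comp_neg z t
  refine ⟨h1.comp contDiff_neg, fun t => ?_, by simpa using h3, ?_, fun t => ?_⟩
  · rw [hd, deriv.fun_neg, deriv_comp_neg, neg_neg, h2]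
  · rw [hd]
    exact (h4.comp tendsto_comap).neg
  · simpa using h5 (-t)

theorem existsUnique_isFreeSol_atBot_of_atTop {Fl : Euc n → Euc n} {a w : Euc n} {C : ℝ}
    (H : ∃! z, IsFreeSol Fl a (-w) atTop C z) : ∃! z, IsFreeSol Fl a w atBot C z := by
  obtain ⟨z, hz, huniq⟩ := H
  refine ⟨fun t => z (-t), ?_, fun z' hz' => ?_⟩
  · simpa using hz.comp_neg
  · have h := hz'.comp_neg
    rw [comap_neg_atBot] at h
    funext t
    simpa using congrFun (huniq _ h) (-t)

theorem integral_rpow_abs {m κ α : ℝ} (hm : 0 < m) (hκ : 0 < κ) (hα : 0 < α) :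
    Integrable (fun t : ℝ => (m + κ * |t|) ^ (-(α + 1))) ∧
      ∫ t : ℝ, (m + κ * |t|) ^ (-(α + 1)) = 2 / (α * κ * m ^ α) := by
  have hpos {t : ℝ} (ht : t ∈ Ici (0:ℝ)) : 0 < m + κ * t := by
    have : 0 ≤ t := ht
    positivity
  have hd (t : ℝ) (ht : t ∈ Ici (0:ℝ)) :
      HasDerivAt (fun s => -(α * κ)⁻¹ * (m + κ * s) ^ (-α)) ((m + κ * t) ^ (-(α + 1))) t := by
    have h1 : HasDerivAt (fun s => m + κ * s) κ t := by
      simpa using ((hasDerivAt_id t).const_mul κ).const_add m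
    refine ((h1.rpow_const (p := -α) (Or.inl (hpos ht).ne')).const_mul _).congr_deriv ?_
    rw [show -α - 1 = -(α + 1) by ring]
    field_simp
  have hnn (t : ℝ) (ht : t ∈ Ioi (0:ℝ)) : 0 ≤ (m + κ * t) ^ (-(α + 1)) :=
    rpow_nonneg (hpos (Ioi_subset_Ici_self ht)).le _
  have hlim : Tendsto (fun s => -(α * κ)⁻¹ * (m + κ * s) ^ (-α)) atTop (𝓝 0) := by
    have h1 : Tendsto (fun s : ℝ => m + κ * s) atTop atTop :=
      tendsto_atTop_add_const_left _ _ (tendsto_id.const_mul_atTop hκ)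
    simpa using ((tendsto_rpow_neg_atTop hα).comp h1).const_mul (-(α * κ)⁻¹)
  constructor
  · rw [← integrableOn_univ, ← Iic_union_Ioi (a := (0:ℝ)), integrableOn_union]
    have hI : IntegrableOn (fun t : ℝ => (m + κ * |t|) ^ (-(α + 1))) (Ioi 0) :=
      (integrableOn_Ioi_deriv_of_nonneg' hd hnn hlim).congr_fun
        (fun t ht => by simp only [abs_of_pos (mem_Ioi.1 ht)]) measurableSet_Ioi
    refine ⟨?_, hI⟩
    rw [integrableOn_Iic_iff_integrableOn_Iio]
    simpa using hI.comp_neg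
  · rw [integral_comp_abs (f := fun s => (m + κ * s) ^ (-(α + 1))),
      integral_Ioi_of_hasDerivAt_of_nonneg' hd hnn hlim, rpow_neg (by simpa using hm.le)]
    simp
    field_simp

theorem norm_gradient_sub_le {V : Euc n → ℝ} (hV : ContDiff ℝ 2 V) {s : Set (Euc n)}
    (hs : Convex ℝ s) {K : ℝ} (hK : ∀ p ∈ s, ‖iteratedFDeriv ℝ 2 V p‖ ≤ K) {p₁ p₂ : Euc n}
    (h₁ : p₁ ∈ s) (h₂ : p₂ ∈ s) : ‖gradient V p₁ - gradient V p₂‖ ≤ K * ‖p₁ - p₂‖ := by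
  rw [gradient, gradient, ← map_sub, LinearIsometryEquiv.norm_map]
  have hd : ContDiff ℝ 1 (fderiv ℝ V) := hV.fderiv_right (by norm_num)
  refine hs.norm_image_sub_le_of_norm_fderiv_le
    (fun p _ => hd.differentiable (by norm_num) p) (fun p hp => ?_) h₂ h₁
  rw [← norm_iteratedFDeriv_one, norm_iteratedFDeriv_fderiv]
  exact hK p hp

theorem continuous_gradient {V : Euc n → ℝ} (hV : ContDiff ℝ 2 V) : Continuous (gradient V) :=
  (LinearIsometryEquiv.continuous _).comp (hV.continuous_fderiv (by norm_num))

theorem add_div_sqrt_two_le_norm_add_smul {v x : Euc n} (hperp : ⟪v, x⟫ = 0) (t : ℝ) :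
    (‖x‖ + ‖v‖ * |t|) / √2 ≤ ‖x + t • v‖ := by
  have h0 : ⟪x, t • v⟫ = 0 := by
    rw [real_inner_smul_right, real_inner_comm, hperp, mul_zero]
  have h1 := norm_add_sq_eq_norm_sq_add_norm_sq_of_inner_eq_zero x (t • v) h0
  rw [norm_smul, Real.norm_eq_abs] at h1
  rw [div_le_iff₀ (by positivity)]
  refine abs_le_of_sq_le_sq' ?_ (by positivity) |>.2
  rw [mul_pow, Real.sq_sqrt (by norm_num)]
  nlinarith [sq_nonneg (‖x‖ - ‖v‖ * |t|)]

theorem add_mul_abs_le_one_add_norm {v x w h p : Euc n} (hperp : ⟪v, x⟫ = 0)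
    (hw : ‖w - v‖ ≤ ‖v‖ / (4 * √2)) {t C : ℝ} (hC : C ≤ ‖v‖ / (4 * √2))
    (hp : ‖p - (x + h + t • w)‖ ≤ C * |t|) :
    1 + ‖x‖ / √2 - ‖h‖ + ‖v‖ / (2 * √2) * |t| ≤ 1 + ‖p‖ := by
  have h1 := add_div_sqrt_two_le_norm_add_smul hperp t
  have h2 : ‖x + t • v‖ ≤ ‖p‖ + ‖p - (x + h + t • w)‖ + ‖h‖ + ‖t • (w - v)‖ := by
    calc ‖x + t • v‖ = ‖p - (p - (x + h + t • w)) - h - t • (w - v)‖ := by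
          congr 1; rw [smul_sub]; abel
      _ ≤ _ := (norm_sub_le _ _).trans (add_le_add_left ((norm_sub_le _ _).trans
          (add_le_add_left (norm_sub_le _ _) _)) _)
  rw [norm_smul, Real.norm_eq_abs] at h2
  have h3 := mul_le_mul_of_nonneg_left hw (abs_nonneg t)
  have h4 := mul_le_mul_of_nonneg_right hC (abs_nonneg t)
  have h5 : (‖x‖ + ‖v‖ * |t|) / √2 = ‖x‖ / √2 + ‖v‖ / (2 * √2) * |t|
      + ‖v‖ / (4 * √2) * |t| + |t| * (‖v‖ / (4 * √2)) := by
    field_simp; ring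
  linarith

theorem existsUnique_isFreeSol_of_longRange {α βl0 βl1 βl2 : ℝ} (hα : 0 < α)
    (hβl1 : 0 < βl1) (hβl2 : 0 < βl2) (hn : 1 ≤ n) {Vl : Euc n → ℝ}
    (hVl : LongRange α βl0 βl1 βl2 Vl) {Fl : Euc n → Euc n} (hFl : ∀ y, Fl y = -gradient Vl y)
    {v x w h : Euc n} (hperp : ⟪v, x⟫ = 0) (hw : ‖w - v‖ ≤ ‖v‖ / (4 * √2))
    (hh : ‖h‖ < 1 + ‖x‖ / √2)
    (hcond : 2 ^ 5 * (n : ℝ) * max βl1 βl2 ≤ α * ‖v‖ ^ 2 * (1 + ‖x‖ / √2 - ‖h‖) ^ α) :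
    ∃! z : ℝ → Euc n, IsFreeSol Fl (x + h) w atTop
      (2 ^ ((5:ℝ)/2) * √n * βl1 / (α * ‖v‖ * (1 + ‖x‖ / √2 - ‖h‖) ^ α)) z := by
  have hF : Fl = fun y => -gradient Vl y := funext hFl
  obtain ⟨hV, -, hV1, hV2⟩ := hVl
  have hadd (t : ℝ) {C : ℝ} {y : Euc n} (hy : ‖y‖ ≤ C * |t|) :
      ‖x + h + t • w + y - (x + h + t • w)‖ ≤ C * |t| := by simpa using hy
  have hn' : (1:ℝ) ≤ n := by exact_mod_cast hn
  have hsn : 1 ≤ √(n:ℝ) := Real.one_le_sqrt.2 hn'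
  have hsn2 : √(n:ℝ) ^ 2 = n := Real.sq_sqrt (by positivity)
  have hs2 : √2 ^ 2 = (2:ℝ) := Real.sq_sqrt (by norm_num)
  have hpow : (2:ℝ) ^ ((5:ℝ)/2) = 4 * √2 := by
    rw [show (5:ℝ)/2 = 2 + 1/2 by norm_num, rpow_add (by norm_num), Real.sqrt_eq_rpow]
    norm_num
  have hv : 0 < ‖v‖ := by
    refine (norm_nonneg v).lt_of_ne fun h0 => ?_
    rw [← h0] at hcond
    have : 0 < 2 ^ 5 * (n : ℝ) * max βl1 βl2 := by positivity
    simp at hcond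
    linarith
  have hβ1 : 2 ^ 5 * (n : ℝ) * βl1 ≤ 2 ^ 5 * (n : ℝ) * max βl1 βl2 := by
    gcongr; exact le_max_left _ _
  have hβ2 : 2 ^ 5 * (n : ℝ) * βl2 ≤ 2 ^ 5 * (n : ℝ) * max βl1 βl2 := by
    gcongr; exact le_max_right _ _
  have hlow {p : Euc n} {t C : ℝ} := @add_mul_abs_le_one_add_norm n v x w h p hperp hw t C
  have hm : 0 < 1 + ‖x‖ / √2 - ‖h‖ := by linarith
  set m := 1 + ‖x‖ / √2 - ‖h‖
  have hM : 0 < m ^ α := rpow_pos_of_pos hm α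
  rw [hpow]
  set C := 4 * √2 * √n * βl1 / (α * ‖v‖ * m ^ α)
  have hC0 : 0 ≤ C := by positivity
  have hC : C ≤ ‖v‖ / (4 * √2) := by
    rw [div_le_div_iff₀ (by positivity) (by positivity)]
    have h1 : √n * βl1 ≤ n * βl1 := by
      gcongr; nlinarith
    calc 4 * √2 * √n * βl1 * (4 * √2) = 16 * √2 ^ 2 * (√n * βl1) := by ring
      _ ≤ 2 ^ 5 * (n : ℝ) * βl1 := by rw [hs2]; linarith
      _ ≤ α * ‖v‖ ^ 2 * m ^ α := hβ1.trans hcond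
      _ = ‖v‖ * (α * ‖v‖ * m ^ α) := by ring
  obtain ⟨κ, hκ⟩ : ∃ κ, κ = ‖v‖ / (2 * √2) := ⟨_, rfl⟩
  have hκ0 : 0 < κ := by rw [hκ]; positivity
  have hκ2 : κ ^ 2 = ‖v‖ ^ 2 / 8 := by
    rw [hκ, div_pow, mul_pow, hs2]; norm_num
  rw [← hκ] at hlow
  have hpos (t : ℝ) : 0 < m + κ * |t| := by positivity
  obtain ⟨hI, hIeq⟩ := integral_rpow_abs hm hκ0 hα
  refine existsUnique_isFreeSol_atTop (q := 1 / 2)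
    (g := fun t => βl1 * (m + κ * |t|) ^ (-(α + 1)))
    (k := fun t => βl2 / κ * (m + κ * |t|) ^ (-(α + 1)))
    (hF ▸ (continuous_gradient hV).neg) (x + h) w hC0 (hI.const_mul _) (hI.const_mul _)
    ?_ ?_ (by norm_num) (by norm_num) ?_ ?_
  · rw [integral_const_mul, hIeq, hκ]
    calc βl1 * (2 / (α * (‖v‖ / (2 * √2)) * m ^ α))
        = 4 * √2 * 1 * βl1 / (α * ‖v‖ * m ^ α) := by field_simp; norm_num
      _ ≤ C := by simp only [C]; gcongr
  · rw [integral_const_mul, hIeq]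
    have : βl2 / κ * (2 / (α * κ * m ^ α)) = 16 * βl2 / (α * ‖v‖ ^ 2 * m ^ α) := by
      calc βl2 / κ * (2 / (α * κ * m ^ α)) = 2 * βl2 / (α * κ ^ 2 * m ^ α) := by field_simp
        _ = _ := by rw [hκ2]; field_simp; norm_num
    rw [this, div_le_iff₀ (by positivity)]
    nlinarith
  · intro t y hy
    rw [hFl, norm_neg]
    refine (hV1 _).trans (mul_le_mul_of_nonneg_left ?_ hβl1.le)
    exact rpow_le_rpow_of_nonpos (hpos t) (hlow hC (hadd t hy)) (by linarith)
  · intro t y₁ y₂ d hd0 hy₁ hy₂ hd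
    have hK : ∀ p ∈ Metric.closedBall (x + h + t • w) (C * |t|),
        ‖iteratedFDeriv ℝ 2 Vl p‖ ≤ βl2 * (m + κ * |t|) ^ (-(α + 2)) := by
      intro p hp
      refine (hV2 p).trans (mul_le_mul_of_nonneg_left ?_ hβl2.le)
      exact rpow_le_rpow_of_nonpos (hpos t) (hlow hC (mem_closedBall_iff_norm.1 hp))
        (by linarith)
    have h1 := norm_gradient_sub_le hV (convex_closedBall _ _) hK
      (mem_closedBall_iff_norm.2 (hadd t hy₁)) (mem_closedBall_iff_norm.2 (hadd t hy₂))
    rw [hFl, hFl, neg_sub_neg, norm_sub_rev]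
    refine h1.trans ?_
    rw [add_sub_add_left_eq_sub]
    have hX : (m + κ * |t|) ^ (-(α + 2)) = (m + κ * |t|) ^ (-(α + 1)) / (m + κ * |t|) := by
      rw [← rpow_sub_one (hpos t).ne']; congr 1; ring
    have hX0 : 0 ≤ (m + κ * |t|) ^ (-(α + 1)) := rpow_nonneg (hpos t).le _
    have hXt : |t| ≤ (m + κ * |t|) / κ := by
      rw [le_div_iff₀ hκ0]; linarith
    have hd' : ‖y₁ - y₂‖ ≤ d * ((m + κ * |t|) / κ) :=
      hd.trans (mul_le_mul_of_nonneg_left hXt hd0)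
    calc βl2 * (m + κ * |t|) ^ (-(α + 2)) * ‖y₁ - y₂‖
        ≤ βl2 * (m + κ * |t|) ^ (-(α + 2)) * (d * ((m + κ * |t|) / κ)) := by gcongr
      _ = βl2 / κ * (m + κ * |t|) ^ (-(α + 1)) * d := by
          rw [hX]
          have := (hpos t).ne'
          field_simp

theorem statement_0
    (n : ℕ) (hn : 2 ≤ n) (α : ℝ) (hα0 : 0 < α) (hα1 : α ≤ 1)
    (Vl Vs : Euc n → ℝ) (βl0 βl1 βl2 βs1 βs2 βs3 : ℝ)
    (hβl0 : 0 < βl0) (hβl1 : 0 < βl1) (hβl2 : 0 < βl2)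
    (hβs1 : 0 < βs1) (hβs2 : 0 < βs2) (hβs3 : 0 < βs3)
    (hVl : LongRange α βl0 βl1 βl2 Vl) (hVs : ShortRange α βs1 βs2 βs3 Vs)
    (Fl Fs F : Euc n → Euc n)
    (hFl : ∀ y, Fl y = -gradient Vl y) (hFs : ∀ y, Fs y = -gradient Vs y)
    (hF : ∀ y, F y = Fl y + Fs y)
    (v x w h : Euc n) (hperp : ⟪v, x⟫ = 0)
    (hw : ‖w - v‖ ≤ ‖v‖ / (4 * Real.sqrt 2))
    (hh : ‖h‖ < 1 + ‖x‖ / Real.sqrt 2)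
    (hcond : 2 ^ 5 * (n : ℝ) * max βl1 βl2 ≤
      α * ‖v‖ ^ 2 * (1 + ‖x‖ / Real.sqrt 2 - ‖h‖) ^ α) :
    (∃! z : ℝ → Euc n, IsFreeSol Fl (x + h) w atTop
        (2 ^ ((5:ℝ)/2) * Real.sqrt n * βl1 /
          (α * ‖v‖ * (1 + ‖x‖ / Real.sqrt 2 - ‖h‖) ^ α)) z) ∧
    (∃! z : ℝ → Euc n, IsFreeSol Fl (x + h) w atBot
        (2 ^ ((5:ℝ)/2) * Real.sqrt n * βl1 /
          (α * ‖v‖ * (1 + ‖x‖ / Real.sqrt 2 - ‖h‖) ^ α)) z) := by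
  have hn1 : 1 ≤ n := by omega
  refine ⟨existsUnique_isFreeSol_of_longRange hα0 hβl1 hβl2 hn1 hVl hFl hperp hw hh hcond,
    existsUnique_isFreeSol_atBot_of_atTop ?_⟩
  have hw' : ‖-w - -v‖ ≤ ‖-v‖ / (4 * √2) := by
    rwa [norm_neg, neg_sub_neg, norm_sub_rev]
  simpa only [norm_neg] using existsUnique_isFreeSol_of_longRange (v := -v) (w := -w)
    hα0 hβl1 hβl2 hn1 hVl hFl (by rw [inner_neg_left, hperp, neg_zero]) hw' hh
    (by rwa [norm_neg])

end Paper
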